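/- Fix an integer p ≥ 1, an even positive integer N, d > 0, Δx = d/N, ω = 2π/d, c ∈ ℝ, ν ≥ 0, t ≥ 0, and complex coefficients a_k for −N/2 ≤ k < N/2. Let λ_k = Σ_{j=1}^p α_j sin(ωkjΔx)/(jΔx) and μ_k = Σ_{j=1}^p α_j (2 − 2cos(ωkjΔx))/(jΔx)² with α_j = 2(−1)^{j+1}(p!)²/((p+j)!(p−j)!). Define u_t(x) = Σ_{k=−N/2}^{N/2−1} a_k e^{−icωkt − νω²k²t} e^{iωkx} and v_t(x) = Σ_{k=−N/2}^{N/2−1} a_k e^{−icλ_k t − νμ_k t} e^{iωkx}, with common initial datum u₀(x) = Σ_k a_k e^{iωkx}. Then, with the normalized L² norm on [0,d] (in which ‖e^{iωkx}‖ = 1), ‖u_t − v_t‖_{L²} ≤ t e^{−νtμ₁} (Δx)^{2p} [c² C_p² ‖u₀^{(2p+1)}‖²_{L²} + ν² (C'_p)² ‖u₀^{(2p+2)}‖²_{L²}]^{1/2}, where μ₁ = μ_1 is the value of μ at k = 1, C_p = (p!)²/(2p+1)!, C'_p = 2(p!)²/(2p+2)!, and ‖u₀^{(m)}‖²_{L²}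 = Σ_{k=−N/2}^{N/2−1} |ωk|^{2m} |a_k|². -/

import Mathlib

open Real Complex

/-- The finite-difference coefficients `α_j = 2(−1)^{j+1}(p!)²/((p+j)!(p−j)!)`. -/
noncomputable def fdAlpha (p j : ℕ) : ℝ :=
  2 * (-1 : ℝ) ^ (j + 1) * (p.factorial : ℝ) ^ 2 /
    ((p + j).factorial * (p - j).factorial)

/-- The eigenvalue symbol `λ_k = Σ_{j=1}^p α_j sin(ωkjΔx)/(jΔx)` of `D_{2p}`. -/
noncomputable def fdLambda (p : ℕ) (ω Δx : ℝ) (k : ℝ) : ℝ :=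
  ∑ j ∈ Finset.Icc 1 p, fdAlpha p j * Real.sin (ω * k * j * Δx) / (j * Δx)

/-- The eigenvalue symbol `μ_k = Σ_{j=1}^p α_j (2 − 2cos(ωkjΔx))/(jΔx)²` of `D^{(2)}_{2p}`. -/
noncomputable def fdMu (p : ℕ) (ω Δx : ℝ) (k : ℝ) : ℝ :=
  ∑ j ∈ Finset.Icc 1 p, fdAlpha p j * (2 - 2 * Real.cos (ω * k * j * Δx)) / (j * Δx) ^ 2

theorem sum_range_two_mul_add_one {M : Type*} [AddCommMonoid M] (f : ℕ → M) (p : ℕ) :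
    ∑ m ∈ Finset.range (2 * p + 1), f m =
      f p + ∑ j ∈ Finset.Icc 1 p, (f (p + j) + f (p - j)) := by
  have h1 : 2 * p + 1 = p + (p + 1) := by ring
  have h2 : ∑ j ∈ Finset.Icc 1 p, (f (p + j) + f (p - j)) =
      ∑ i ∈ Finset.range p, (f (p + (i + 1)) + f (p - 1 - i)) := by
    refine Finset.sum_nbij' (· - 1) (· + 1) ?_ ?_ ?_ ?_ fun j hj => ?_
    · simp only [Finset.mem_Icc, Finset.mem_range]; omega
    · simp only [Finset.mem_Icc, Finset.mem_range]; omega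
    · simp only [Finset.mem_Icc]; omega
    · simp
    · rw [Finset.mem_Icc] at hj
      rw [show j - 1 + 1 = j by omega, show p - 1 - (j - 1) = p - j by omega]
  rw [h1, Finset.sum_range_add, Finset.sum_range_succ', h2, Finset.sum_add_distrib,
    Finset.sum_range_reflect]
  simp only [add_zero]
  abel

theorem two_mul_sin_half_pow (p : ℕ) (θ : ℝ) :
    4 ^ p * Real.sin (θ / 2) ^ (2 * p) =
      ∑ m ∈ Finset.range (2 * p + 1),
        (-1 : ℝ) ^ (m + p) * (2 * p).choose m * Real.cos (((m : ℝ) - p) * θ) := by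
  have key : ((4 ^ p * Real.sin (θ / 2) ^ (2 * p) : ℝ) : ℂ) =
      ∑ m ∈ Finset.range (2 * p + 1),
        (((-1 : ℝ) ^ (m + p) * (2 * p).choose m : ℝ) : ℂ) *
          Complex.exp (((((m : ℝ) - p) * θ : ℝ) : ℂ) * Complex.I) := by
    have h0 : (2 * Complex.sin (θ / 2)) ^ 2 =
        -(Complex.exp (θ / 2 * Complex.I) + -Complex.exp (-(θ / 2) * Complex.I)) ^ 2 := by
      rw [Complex.sin]
      ring_nf
      simp only [Complex.I_sq]
      ring
    have h1 : ((4 ^ p * Real.sin (θ / 2) ^ (2 * p) : ℝ) : ℂ) =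
        (-1) ^ p * (Complex.exp (θ / 2 * Complex.I) +
          -Complex.exp (-(θ / 2) * Complex.I)) ^ (2 * p) := by
      rw [pow_mul (_ + _), ← mul_pow, neg_one_mul, ← h0, mul_pow, mul_pow, ← pow_mul]
      push_cast
      rw [pow_mul, pow_mul, show (2 : ℂ) ^ 2 = 4 by norm_num]
    rw [h1, add_pow, Finset.mul_sum]
    refine Finset.sum_congr rfl fun m hm => ?_
    have hm' : m ≤ 2 * p := by simpa [Nat.lt_succ_iff] using hm
    rw [neg_pow (Complex.exp _), ← Complex.exp_nat_mul, ← Complex.exp_nat_mul]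
    have hs : (-1 : ℂ) ^ (2 * p - m) = (-1) ^ m := by
      rcases Nat.even_or_odd m with h | h
      · rw [h.neg_one_pow, Even.neg_one_pow]
        exact (Nat.even_sub hm').2 (by simp [h])
      · rw [h.neg_one_pow, Odd.neg_one_pow]
        exact (Nat.odd_sub hm').2 (by grind)
    have he : Complex.exp ((((m : ℝ) - p) * θ : ℝ) * Complex.I) =
        Complex.exp (m * (θ / 2 * Complex.I)) *
          Complex.exp ((2 * p - m : ℕ) * (-(θ / 2) * Complex.I)) := by
      rw [← Complex.exp_add]
      congr 1
      push_cast [Nat.cast_sub hm']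
      ring
    rw [hs, he, pow_add]
    push_cast
    ring
  have := congrArg Complex.re key
  rw [Complex.ofReal_re, Complex.re_sum] at this
  rw [this]
  refine Finset.sum_congr rfl fun m _ => ?_
  rw [Complex.re_ofReal_mul, Complex.exp_ofReal_mul_I_re]

theorem one_sub_sum_fdAlpha_mul_cos (p : ℕ) (θ : ℝ) :
    1 - ∑ j ∈ Finset.Icc 1 p, fdAlpha p j * Real.cos (j * θ) =
      (p.factorial : ℝ) ^ 2 / (2 * p).factorial * (4 ^ p * Real.sin (θ / 2) ^ (2 * p)) := by
  have hp := Nat.factorial_ne_zero p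
  have h2p := Nat.factorial_ne_zero (2 * p)
  rw [two_mul_sin_half_pow, sum_range_two_mul_add_one, mul_add, Finset.mul_sum, sub_eq_add_neg,
    ← Finset.sum_neg_distrib]
  congr 1
  · rw [Nat.cast_choose ℝ (by omega : p ≤ 2 * p), ← two_mul, show 2 * p - p = p by omega]
    simp
    field_simp
  · refine Finset.sum_congr rfl fun j hj => ?_
    have hj' : j ≤ p := (Finset.mem_Icc.1 hj).2
    rw [Nat.cast_choose ℝ (by omega : p + j ≤ 2 * p), Nat.cast_choose ℝ (by omega : p - j ≤ 2 * p),
      show 2 * p - (p + j) = p - j by omega, show 2 * p - (p - j) = p + j by omega, fdAlpha]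
    have h1 := Nat.factorial_ne_zero (p + j)
    have h2 := Nat.factorial_ne_zero (p - j)
    have hs : (-1 : ℝ) ^ (p - j + p) = (-1) ^ j := by
      have : p - j + p + 2 * j = 2 * p + j := by omega
      have h := congrArg (fun n => (-1 : ℝ) ^ n) this
      simpa [pow_add, pow_mul] using h
    have hs' : (-1 : ℝ) ^ (p + j + p) = (-1) ^ j := by
      rw [show p + j + p = 2 * p + j by ring, pow_add, pow_mul]
      simp
    have hc : Real.cos ((((p - j : ℕ) : ℝ) - p) * θ) = Real.cos (j * θ) := by
      rw [← Real.cos_neg]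
      congr 1
      push_cast [Nat.cast_sub hj']
      ring
    have hc' : Real.cos ((((p + j : ℕ) : ℝ) - p) * θ) = Real.cos (j * θ) := by
      congr 1
      push_cast
      ring
    rw [hs, hs', hc, hc', pow_succ]
    field_simp
    ring

/-- The symbol of `Δx D_{2p}` divided by `i`, as a function of the angle `θ = ωkΔx`. -/
noncomputable def fdSinSymbol (p : ℕ) (θ : ℝ) : ℝ :=
  ∑ j ∈ Finset.Icc 1 p, fdAlpha p j * Real.sin (j * θ) / j

/-- The symbol of `-Δx² D^{(2)}_{2p}`, as a function of the angle `θ = ωkΔx`. -/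
noncomputable def fdCosSymbol (p : ℕ) (θ : ℝ) : ℝ :=
  ∑ j ∈ Finset.Icc 1 p, fdAlpha p j * (2 - 2 * Real.cos (j * θ)) / (j : ℝ) ^ 2

theorem fdLambda_eq (p : ℕ) (ω Δx k : ℝ) :
    fdLambda p ω Δx k = fdSinSymbol p (ω * k * Δx) / Δx := by
  rw [fdLambda, fdSinSymbol, Finset.sum_div]
  refine Finset.sum_congr rfl fun j _ => ?_
  rw [div_div, show ω * k * j * Δx = j * (ω * k * Δx) by ring]

theorem fdMu_eq (p : ℕ) (ω Δx k : ℝ) :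
    fdMu p ω Δx k = fdCosSymbol p (ω * k * Δx) / Δx ^ 2 := by
  rw [fdMu, fdCosSymbol, Finset.sum_div]
  refine Finset.sum_congr rfl fun j _ => ?_
  rw [div_div, mul_pow, show ω * k * j * Δx = j * (ω * k * Δx) by ring]

theorem fdSinSymbol_neg (p : ℕ) (θ : ℝ) : fdSinSymbol p (-θ) = -fdSinSymbol p θ := by
  simp [fdSinSymbol, neg_div]

theorem fdCosSymbol_neg (p : ℕ) (θ : ℝ) : fdCosSymbol p (-θ) = fdCosSymbol p θ := by
  simp [fdCosSymbol]

theorem fdCosSymbol_abs (p : ℕ) (θ : ℝ) : fdCosSymbol p |θ| = fdCosSymbol p θ := by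
  rcases abs_choice θ with h | h <;> rw [h]
  exact fdCosSymbol_neg p θ

theorem hasDerivAt_fdSinSymbol (p : ℕ) (θ : ℝ) :
    HasDerivAt (fdSinSymbol p)
      (1 - (p.factorial : ℝ) ^ 2 / (2 * p).factorial *
        (4 ^ p * Real.sin (θ / 2) ^ (2 * p))) θ := by
  rw [← one_sub_sum_fdAlpha_mul_cos, sub_sub_cancel]
  unfold fdSinSymbol
  refine HasDerivAt.fun_sum fun j hj => ?_
  have hj0 : (j : ℝ) ≠ 0 := by
    have := (Finset.mem_Icc.1 hj).1
    positivity
  have h := ((((hasDerivAt_id θ).const_mul (j : ℝ)).sin).const_mul (fdAlpha p j)).div_const (j : ℝ)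
  refine h.congr_deriv ?_
  simp only [id]
  field_simp

theorem hasDerivAt_fdCosSymbol (p : ℕ) (θ : ℝ) :
    HasDerivAt (fdCosSymbol p) (2 * fdSinSymbol p θ) θ := by
  unfold fdCosSymbol fdSinSymbol
  rw [Finset.mul_sum]
  refine HasDerivAt.fun_sum fun j hj => ?_
  have hj0 : (j : ℝ) ≠ 0 := by
    have := (Finset.mem_Icc.1 hj).1
    positivity
  have h := (((((hasDerivAt_id θ).const_mul (j : ℝ)).cos.const_mul 2).const_sub 2).const_mul
    (fdAlpha p j)).div_const ((j : ℝ) ^ 2)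
  refine h.congr_deriv ?_
  simp only [id]
  field_simp

theorem fdSinSymbol_zero (p : ℕ) : fdSinSymbol p 0 = 0 := by simp [fdSinSymbol]

theorem fdCosSymbol_zero (p : ℕ) : fdCosSymbol p 0 = 0 := by simp [fdCosSymbol]

theorem nonneg_of_hasDerivAt_nonneg {f f' : ℝ → ℝ} (hf : ∀ x, HasDerivAt f (f' x) x)
    (h0 : f 0 = 0) (hf' : ∀ x, 0 < x → 0 ≤ f' x) {x : ℝ} (hx : 0 ≤ x) : 0 ≤ f x := by
  have hm : MonotoneOn f (Set.Ici 0) :=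
    monotoneOn_of_hasDerivWithinAt_nonneg (convex_Ici 0)
      (fun x _ => (hf x).continuousAt.continuousWithinAt)
      (fun x _ => (hf x).hasDerivWithinAt) (fun x hx => hf' x (by simpa using hx))
  simpa [h0] using hm (Set.mem_Ici.2 le_rfl) (Set.mem_Ici.2 hx) hx

theorem sub_fdSinSymbol_nonneg (p : ℕ) {θ : ℝ} (hθ : 0 ≤ θ) : 0 ≤ θ - fdSinSymbol p θ := by
  refine nonneg_of_hasDerivAt_nonneg (f := fun θ => θ - fdSinSymbol p θ)
    (fun x => (hasDerivAt_id x).sub (hasDerivAt_fdSinSymbol p x))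
    (by simp [fdSinSymbol_zero]) (fun x _ => ?_) hθ
  rw [sub_sub_cancel, pow_mul]
  positivity

theorem sub_fdSinSymbol_le (p : ℕ) {θ : ℝ} (hθ : 0 ≤ θ) :
    θ - fdSinSymbol p θ ≤
      (p.factorial : ℝ) ^ 2 / (2 * p + 1).factorial * θ ^ (2 * p + 1) := by
  rw [← sub_nonneg]
  refine nonneg_of_hasDerivAt_nonneg
    (f := fun θ => (p.factorial : ℝ) ^ 2 / (2 * p + 1).factorial * θ ^ (2 * p + 1) -
      (θ - fdSinSymbol p θ))
    (fun x => ((hasDerivAt_pow (2 * p + 1) x).const_mul _).sub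
      ((hasDerivAt_id x).sub (hasDerivAt_fdSinSymbol p x)))
    (by simp [fdSinSymbol_zero]) (fun x hx => ?_) hθ
  have hsin : 4 ^ p * Real.sin (x / 2) ^ (2 * p) ≤ x ^ (2 * p) := by
    have h : Real.sin (x / 2) ^ 2 ≤ (x / 2) ^ 2 := sq_le_sq.2 Real.abs_sin_le_abs
    calc 4 ^ p * Real.sin (x / 2) ^ (2 * p) = (4 * Real.sin (x / 2) ^ 2) ^ p := by
          rw [mul_pow, ← pow_mul]
      _ ≤ (x ^ 2) ^ p := by
          gcongr
          linarith [h]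
      _ = x ^ (2 * p) := by rw [← pow_mul]
  have hC : (p.factorial : ℝ) ^ 2 / (2 * p + 1).factorial * ((2 * p + 1 : ℕ) * x ^ (2 * p)) =
      (p.factorial : ℝ) ^ 2 / (2 * p).factorial * x ^ (2 * p) := by
    have h2p := Nat.factorial_ne_zero (2 * p)
    rw [Nat.factorial_succ]
    push_cast
    field_simp
  rw [sub_sub_cancel, Nat.add_sub_cancel, hC, sub_nonneg]
  gcongr

theorem abs_sub_fdSinSymbol_le (p : ℕ) (θ : ℝ) :
    |θ - fdSinSymbol p θ| ≤
      (p.factorial : ℝ) ^ 2 / (2 * p + 1).factorial * |θ| ^ (2 * p + 1) := by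
  wlog hθ : 0 ≤ θ generalizing θ
  · have := this (-θ) (by linarith)
    rwa [fdSinSymbol_neg, abs_neg, ← neg_sub', abs_neg] at this
  rw [abs_of_nonneg hθ, abs_of_nonneg (sub_fdSinSymbol_nonneg p hθ)]
  exact sub_fdSinSymbol_le p hθ

theorem hasDerivAt_sq_sub_fdCosSymbol (p : ℕ) (θ : ℝ) :
    HasDerivAt (fun θ => θ ^ 2 - fdCosSymbol p θ) (2 * (θ - fdSinSymbol p θ)) θ := by
  refine ((hasDerivAt_pow 2 θ).sub (hasDerivAt_fdCosSymbol p θ)).congr_deriv ?_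
  simp
  ring

theorem fdCosSymbol_le_sq (p : ℕ) (θ : ℝ) : fdCosSymbol p θ ≤ θ ^ 2 := by
  rw [← fdCosSymbol_abs, ← sq_abs, ← sub_nonneg]
  exact nonneg_of_hasDerivAt_nonneg (hasDerivAt_sq_sub_fdCosSymbol p)
    (by simp [fdCosSymbol_zero])
    (fun x hx => mul_nonneg two_pos.le (sub_fdSinSymbol_nonneg p hx.le)) (abs_nonneg θ)

theorem sq_sub_fdCosSymbol_le (p : ℕ) (θ : ℝ) :
    θ ^ 2 - fdCosSymbol p θ ≤
      2 * (p.factorial : ℝ) ^ 2 / (2 * p + 2).factorial * |θ| ^ (2 * p + 2) := by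
  rw [← fdCosSymbol_abs, ← sq_abs, ← sub_nonneg]
  refine nonneg_of_hasDerivAt_nonneg
    (f := fun θ => 2 * (p.factorial : ℝ) ^ 2 / (2 * p + 2).factorial * θ ^ (2 * p + 2) -
      (θ ^ 2 - fdCosSymbol p θ))
    (fun x => ((hasDerivAt_pow (2 * p + 2) x).const_mul _).sub
      (hasDerivAt_sq_sub_fdCosSymbol p x))
    (by simp [fdCosSymbol_zero]) (fun x hx => ?_) (abs_nonneg θ)
  have hC : 2 * (p.factorial : ℝ) ^ 2 / (2 * p + 2).factorial *
      ((2 * p + 2 : ℕ) * x ^ (2 * p + 1)) =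
      2 * ((p.factorial : ℝ) ^ 2 / (2 * p + 1).factorial * x ^ (2 * p + 1)) := by
    have h2p := Nat.factorial_ne_zero (2 * p + 1)
    rw [Nat.factorial_succ (2 * p + 1)]
    push_cast
    field_simp
    ring
  rw [show 2 * p + 2 - 1 = 2 * p + 1 by omega, hC]
  linarith [sub_fdSinSymbol_le p hx.le]

theorem fdSinSymbol_pi (p : ℕ) : fdSinSymbol p Real.pi = 0 := by
  simp [fdSinSymbol, Real.sin_nat_mul_pi]

theorem fdSinSymbol_nonneg (p : ℕ) {θ : ℝ} (h0 : 0 ≤ θ) (hπ : θ ≤ Real.pi) :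
    0 ≤ fdSinSymbol p θ := by
  have hanti : AntitoneOn (deriv (fdSinSymbol p)) (interior (Set.Icc 0 Real.pi)) := by
    rw [interior_Icc]
    intro x hx y hy hxy
    rw [(hasDerivAt_fdSinSymbol p x).deriv, (hasDerivAt_fdSinSymbol p y).deriv]
    have hsx : 0 ≤ Real.sin (x / 2) :=
      Real.sin_nonneg_of_nonneg_of_le_pi (by linarith [hx.1]) (by linarith [hx.2, Real.pi_pos])
    have hsin : Real.sin (x / 2) ≤ Real.sin (y / 2) :=
      Real.sin_le_sin_of_le_of_le_pi_div_two (by linarith [hx.1, Real.pi_pos])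
        (by linarith [hy.2]) (by linarith)
    gcongr
  have hconc : ConcaveOn ℝ (Set.Icc 0 Real.pi) (fdSinSymbol p) :=
    hanti.concaveOn_of_deriv (convex_Icc _ _)
      (fun x _ => (hasDerivAt_fdSinSymbol p x).continuousAt.continuousWithinAt)
      (fun x _ => (hasDerivAt_fdSinSymbol p x).differentiableAt.differentiableWithinAt)
  have h := hconc.ge_on_segment (Set.left_mem_Icc.2 Real.pi_pos.le)
    (Set.right_mem_Icc.2 Real.pi_pos.le)
    (z := θ) (by rw [segment_eq_Icc Real.pi_pos.le]; exact ⟨h0, hπ⟩)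
  simpa [fdSinSymbol_zero, fdSinSymbol_pi] using h

theorem monotoneOn_fdCosSymbol (p : ℕ) :
    MonotoneOn (fdCosSymbol p) (Set.Icc 0 Real.pi) := by
  refine monotoneOn_of_hasDerivWithinAt_nonneg (convex_Icc _ _)
    (fun x _ => (hasDerivAt_fdCosSymbol p x).continuousAt.continuousWithinAt)
    (fun x _ => (hasDerivAt_fdCosSymbol p x).hasDerivWithinAt) (fun x hx => ?_)
  rw [interior_Icc] at hx
  exact mul_nonneg two_pos.le (fdSinSymbol_nonneg p hx.1.le hx.2.le)

theorem abs_sub_fdLambda_le (p : ℕ) {Δx : ℝ} (hΔx : 0 < Δx) (ω k : ℝ) :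
    |ω * k - fdLambda p ω Δx k| ≤
      Δx ^ (2 * p) * ((p.factorial : ℝ) ^ 2 / (2 * p + 1).factorial) *
        |ω * k| ^ (2 * p + 1) := by
  have h := abs_sub_fdSinSymbol_le p (ω * k * Δx)
  have he : ω * k - fdLambda p ω Δx k = (ω * k * Δx - fdSinSymbol p (ω * k * Δx)) / Δx := by
    rw [fdLambda_eq]
    field_simp
  rw [he, abs_div, abs_of_pos hΔx, div_le_iff₀ hΔx]
  refine h.trans_eq ?_
  rw [abs_mul, abs_of_pos hΔx]
  ring

theorem fdMu_le_sq (p : ℕ) {Δx : ℝ} (hΔx : 0 < Δx) (ω k : ℝ) :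
    fdMu p ω Δx k ≤ (ω * k) ^ 2 := by
  rw [fdMu_eq, div_le_iff₀ (by positivity), ← mul_pow]
  exact fdCosSymbol_le_sq p _

theorem sq_sub_fdMu_le (p : ℕ) {Δx : ℝ} (hΔx : 0 < Δx) (ω k : ℝ) :
    (ω * k) ^ 2 - fdMu p ω Δx k ≤
      Δx ^ (2 * p) * (2 * (p.factorial : ℝ) ^ 2 / (2 * p + 2).factorial) *
        |ω * k| ^ (2 * p + 2) := by
  have h := sq_sub_fdCosSymbol_le p (ω * k * Δx)
  have he : (ω * k) ^ 2 - fdMu p ω Δx k =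
      ((ω * k * Δx) ^ 2 - fdCosSymbol p (ω * k * Δx)) / Δx ^ 2 := by
    rw [fdMu_eq]
    field_simp
  rw [he, div_le_iff₀ (by positivity)]
  refine h.trans_eq ?_
  rw [abs_mul, abs_of_pos hΔx]
  ring

theorem fdMu_one_le (p : ℕ) {ω Δx k : ℝ} (h0 : 0 ≤ ω * Δx) (hk : 1 ≤ |k|)
    (hkπ : ω * Δx * |k| ≤ Real.pi) : fdMu p ω Δx 1 ≤ fdMu p ω Δx k := by
  have h1 : ω * Δx ≤ ω * Δx * |k| := le_mul_of_one_le_right h0 hk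
  rw [fdMu_eq, fdMu_eq, ← fdCosSymbol_abs p (ω * k * Δx), mul_one,
    show ω * k * Δx = ω * Δx * k by ring, abs_mul, abs_of_nonneg h0]
  gcongr
  exact monotoneOn_fdCosSymbol p ⟨h0, h1.trans hkπ⟩ ⟨h0.trans h1, hkπ⟩ h1

theorem Complex.norm_exp_sub_exp_le {M : ℝ} {z w : ℂ} (hz : z.re ≤ M) (hw : w.re ≤ M) :
    ‖Complex.exp z - Complex.exp w‖ ≤ Real.exp M * ‖z - w‖ := by
  refine (convex_halfSpace_re_le M).norm_image_sub_le_of_norm_deriv_le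
    (fun x _ => Complex.differentiableAt_exp) (fun x hx => ?_) hw hz
  rw [Complex.deriv_exp, Complex.norm_exp]
  exact Real.exp_le_exp.2 hx

theorem integral_exp_int_mul {d : ℝ} (hd : 0 < d) (n : ℤ) :
    ∫ x in (0 : ℝ)..d, Complex.exp (Complex.I * (2 * Real.pi / d : ℝ) * n * x) =
      if n = 0 then (d : ℂ) else 0 := by
  split_ifs with hn
  · simp [hn]
  · have hdc : (d : ℂ) ≠ 0 := Complex.ofReal_ne_zero.2 hd.ne'
    have hne : Complex.I * (2 * Real.pi / d : ℝ) * (n : ℂ) ≠ 0 := by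
      simp [hn, hd.ne', Real.pi_ne_zero]
    rw [integral_exp_mul_complex hne]
    have : Complex.I * (2 * Real.pi / d : ℝ) * (n : ℂ) * d = n * (2 * Real.pi * Complex.I) := by
      push_cast
      field_simp
    rw [this, Complex.exp_int_mul_two_pi_mul_I]
    simp

theorem integral_norm_sq_sum_exp {d : ℝ} (hd : 0 < d) (s : Finset ℤ) (b : ℤ → ℂ) :
    ∫ x in (0 : ℝ)..d,
        ‖∑ k ∈ s, b k * Complex.exp (Complex.I * (2 * Real.pi / d : ℝ) * k * x)‖ ^ 2 =
      d * ∑ k ∈ s, ‖b k‖ ^ 2 := by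
  rw [← Complex.ofReal_inj, ← intervalIntegral.integral_ofReal]
  have h : ∀ x : ℝ,
      ((‖∑ k ∈ s, b k * Complex.exp (Complex.I * (2 * Real.pi / d : ℝ) * k * x)‖ ^ 2 : ℝ) : ℂ) =
        ∑ k ∈ s, ∑ l ∈ s, b k * (starRingEnd ℂ) (b l) *
          Complex.exp (Complex.I * (2 * Real.pi / d : ℝ) * ((k - l : ℤ) : ℂ) * x) := by
    intro x
    rw [Complex.ofReal_pow, ← Complex.mul_conj', map_sum, Finset.sum_mul_sum]
    refine Finset.sum_congr rfl fun k _ => Finset.sum_congr rfl fun l _ => ?_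
    have he : Complex.exp (Complex.I * (2 * Real.pi / d : ℝ) * ((k - l : ℤ) : ℂ) * x) =
        Complex.exp (Complex.I * (2 * Real.pi / d : ℝ) * k * x) *
          (starRingEnd ℂ) (Complex.exp (Complex.I * (2 * Real.pi / d : ℝ) * l * x)) := by
      rw [← Complex.exp_conj, ← Complex.exp_add]
      congr 1
      simp only [map_mul, Complex.conj_I, Complex.conj_ofReal, map_intCast]
      push_cast
      ring
    rw [he, map_mul]
    ring
  simp_rw [h]
  rw [intervalIntegral.integral_finsetSum
    fun k _ => (by fun_prop : Continuous _).intervalIntegrable _ _]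
  rw [Complex.ofReal_mul, Complex.ofReal_sum, Finset.mul_sum]
  refine Finset.sum_congr rfl fun k hk => ?_
  rw [intervalIntegral.integral_finsetSum
    fun l _ => (by fun_prop : Continuous _).intervalIntegrable _ _]
  simp_rw [intervalIntegral.integral_const_mul]
  simp_rw [integral_exp_int_mul hd, sub_eq_zero]
  simp [hk, Complex.mul_conj', mul_comm]

theorem norm_sq_amplification_sub_le {c ν t ω lam mu mu₁ k : ℝ} (hν : 0 ≤ ν) (ht : 0 ≤ t)
    (hmu : mu ≤ (ω * k) ^ 2) (hmu₁ : mu₁ ≤ mu) :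
    ‖Complex.exp (-(Complex.I * c * ω * k * t) - ν * ω ^ 2 * k ^ 2 * t) -
        Complex.exp (-(Complex.I * c * lam * t) - mu * ν * t)‖ ^ 2 ≤
      (t * Real.exp (-(ν * t * mu₁))) ^ 2 *
        (c ^ 2 * (ω * k - lam) ^ 2 + ν ^ 2 * ((ω * k) ^ 2 - mu) ^ 2) := by
  have hz : -(Complex.I * c * ω * k * t) - ν * ω ^ 2 * k ^ 2 * t =
      ((-(ν * t * (ω * k) ^ 2) : ℝ) : ℂ) + ((-(c * (ω * k) * t) : ℝ) : ℂ) * Complex.I := by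
    push_cast
    ring
  have hw : -(Complex.I * c * lam * t) - mu * ν * t =
      ((-(ν * t * mu) : ℝ) : ℂ) + ((-(c * lam * t) : ℝ) : ℂ) * Complex.I := by
    push_cast
    ring
  have hνt : 0 ≤ ν * t := mul_nonneg hν ht
  have hsub : ∀ x y x₂ y₂ : ℝ,
      ‖((x : ℂ) + y * Complex.I) - ((x₂ : ℂ) + y₂ * Complex.I)‖ ^ 2 =
        (x - x₂) ^ 2 + (y - y₂) ^ 2 := by
    intro x y x₂ y₂
    rw [Complex.sq_norm, Complex.normSq_apply]
    simp
    ring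
  rw [hz, hw]
  have h := Complex.norm_exp_sub_exp_le (M := -(ν * t * mu₁))
    (z := ((-(ν * t * (ω * k) ^ 2) : ℝ) : ℂ) + ((-(c * (ω * k) * t) : ℝ) : ℂ) * Complex.I)
    (w := ((-(ν * t * mu) : ℝ) : ℂ) + ((-(c * lam * t) : ℝ) : ℂ) * Complex.I)
    (by simpa [-Complex.ofReal_pow, -Complex.ofReal_mul, -Complex.ofReal_neg] using
      mul_le_mul_of_nonneg_left (hmu₁.trans hmu) hνt)
    (by simpa using mul_le_mul_of_nonneg_left hmu₁ hνt)
  refine (pow_le_pow_left₀ (norm_nonneg _) h 2).trans_eq ?_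
  rw [mul_pow, hsub]
  ring

/-- L² error estimate between the exact solution `u_t` of the advection-diffusion equation
and the exact solution `v_t` of the difference-differential equation
`∂_t v = (−cD_{2p} + νD^{(2)}_{2p})v` with the same initial datum
`u₀(x) = Σ_{k=−N/2}^{N/2−1} a_k e^{iωkx}`:
`‖u_t − v_t‖ ≤ t e^{−νtμ₁}(Δx)^{2p} [c²C_p²‖u₀^{(2p+1)}‖² + ν²(C'_p)²‖u₀^{(2p+2)}‖²]^{1/2}`,
with the normalized L² norm on `[0,d]` and `‖u₀^{(m)}‖² = Σ_k |ωk|^{2m}|a_k|²`. -/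
theorem advection_diffusion_fd_error (p : ℕ) (hp : 1 ≤ p) (N : ℕ) (hN : Even N)
    (hNpos : 0 < N) (d : ℝ) (hd : 0 < d) (Δx ω : ℝ) (hΔx : Δx = d / N)
    (hω : ω = 2 * Real.pi / d) (c ν t : ℝ) (hν : 0 ≤ ν) (ht : 0 ≤ t)
    (a : ℤ → ℂ) (ut vt : ℝ → ℂ)
    (hut : ∀ x : ℝ, ut x = ∑ k ∈ Finset.Icc (-(N : ℤ) / 2) ((N : ℤ) / 2 - 1),
      a k * Complex.exp (-(Complex.I * c * ω * (k : ℂ) * t) - ν * ω ^ 2 * (k : ℂ) ^ 2 * t) *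
        Complex.exp (Complex.I * ω * (k : ℂ) * x))
    (hvt : ∀ x : ℝ, vt x = ∑ k ∈ Finset.Icc (-(N : ℤ) / 2) ((N : ℤ) / 2 - 1),
      a k * Complex.exp (-(Complex.I * c * (fdLambda p ω Δx (k : ℝ)) * t) -
          (fdMu p ω Δx (k : ℝ)) * ν * t) *
        Complex.exp (Complex.I * ω * (k : ℂ) * x)) :
    Real.sqrt (d⁻¹ * ∫ x in (0 : ℝ)..d, ‖ut x - vt x‖ ^ 2) ≤
      t * Real.exp (-(ν * t * fdMu p ω Δx 1)) * Δx ^ (2 * p) *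
        Real.sqrt
          (c ^ 2 * ((p.factorial : ℝ) ^ 2 / (2 * p + 1).factorial) ^ 2 *
              (∑ k ∈ Finset.Icc (-(N : ℤ) / 2) ((N : ℤ) / 2 - 1),
                |ω * (k : ℝ)| ^ (2 * (2 * p + 1)) * ‖a k‖ ^ 2) +
            ν ^ 2 * (2 * (p.factorial : ℝ) ^ 2 / (2 * p + 2).factorial) ^ 2 *
              (∑ k ∈ Finset.Icc (-(N : ℤ) / 2) ((N : ℤ) / 2 - 1),
                |ω * (k : ℝ)| ^ (2 * (2 * p + 2)) * ‖a k‖ ^ 2)) := by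
  have hN0 : (0 : ℝ) < N := Nat.cast_pos.2 hNpos
  have hΔx0 : 0 < Δx := hΔx ▸ div_pos hd hN0
  have hωΔx : ω * Δx = 2 * Real.pi / N := by
    rw [hω, hΔx]
    field_simp
  set s := Finset.Icc (-(N : ℤ) / 2) ((N : ℤ) / 2 - 1) with hs
  set E : ℝ := t * Real.exp (-(ν * t * fdMu p ω Δx 1))
  set C : ℝ := (p.factorial : ℝ) ^ 2 / (2 * p + 1).factorial
  set C' : ℝ := 2 * (p.factorial : ℝ) ^ 2 / (2 * p + 2).factorial
  set b : ℤ → ℂ := fun k =>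
    a k * (Complex.exp (-(Complex.I * c * ω * ((k : ℝ) : ℂ) * t) -
        ν * ω ^ 2 * ((k : ℝ) : ℂ) ^ 2 * t) -
      Complex.exp (-(Complex.I * c * (fdLambda p ω Δx (k : ℝ)) * t) -
        (fdMu p ω Δx (k : ℝ)) * ν * t)) with hb
  have hdiff : ∀ x : ℝ, ut x - vt x =
      ∑ k ∈ s, b k * Complex.exp (Complex.I * (2 * Real.pi / d : ℝ) * k * x) := by
    intro x
    rw [hut, hvt, ← Finset.sum_sub_distrib, ← hω]
    refine Finset.sum_congr rfl fun k _ => ?_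
    simp only [hb, Complex.ofReal_intCast]
    ring
  have hbk : ∀ k ∈ s, ‖b k‖ ^ 2 ≤ (E * Δx ^ (2 * p)) ^ 2 *
      (c ^ 2 * C ^ 2 * (|ω * (k : ℝ)| ^ (2 * (2 * p + 1)) * ‖a k‖ ^ 2) +
        ν ^ 2 * C' ^ 2 * (|ω * (k : ℝ)| ^ (2 * (2 * p + 2)) * ‖a k‖ ^ 2)) := by
    intro k hk
    rcases eq_or_ne k 0 with rfl | hk0
    · have : b 0 = 0 := by simp [hb, fdLambda, fdMu]
      rw [this, norm_zero, zero_pow two_ne_zero]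
      positivity
    have hk1 : (1 : ℝ) ≤ |(k : ℝ)| := by exact_mod_cast Int.one_le_abs hk0
    have hkN : 2 * |(k : ℝ)| ≤ N := by
      have : 2 * |k| ≤ N := by
        rw [hs, Finset.mem_Icc] at hk
        obtain ⟨m, rfl⟩ := hN
        push_cast at hk ⊢
        rcases abs_cases k with h | h <;> omega
      exact_mod_cast this
    have hkπ : ω * Δx * |(k : ℝ)| ≤ Real.pi := by
      rw [hωΔx, div_mul_eq_mul_div, div_le_iff₀ hN0]
      nlinarith [Real.pi_pos]
    have hamp := norm_sq_amplification_sub_le (c := c) (lam := fdLambda p ω Δx k) hν ht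
      (fdMu_le_sq p hΔx0 ω k) (fdMu_one_le p (by rw [hωΔx]; positivity) hk1 hkπ)
    have h1 : (ω * k - fdLambda p ω Δx k) ^ 2 ≤
        (Δx ^ (2 * p) * C * |ω * k| ^ (2 * p + 1)) ^ 2 :=
      sq_le_sq.2 ((abs_sub_fdLambda_le p hΔx0 ω k).trans (le_abs_self _))
    have h2 : ((ω * k) ^ 2 - fdMu p ω Δx k) ^ 2 ≤
        (Δx ^ (2 * p) * C' * |ω * k| ^ (2 * p + 2)) ^ 2 :=
      pow_le_pow_left₀ (sub_nonneg.2 (fdMu_le_sq p hΔx0 ω k)) (sq_sub_fdMu_le p hΔx0 ω k) 2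
    calc ‖b k‖ ^ 2 ≤ ‖a k‖ ^ 2 * (E ^ 2 * (c ^ 2 * (ω * k - fdLambda p ω Δx k) ^ 2 +
          ν ^ 2 * ((ω * k) ^ 2 - fdMu p ω Δx k) ^ 2)) := by
          rw [hb, norm_mul, mul_pow]
          exact mul_le_mul_of_nonneg_left hamp (sq_nonneg _)
      _ ≤ ‖a k‖ ^ 2 * (E ^ 2 * (c ^ 2 * (Δx ^ (2 * p) * C * |ω * k| ^ (2 * p + 1)) ^ 2 +
          ν ^ 2 * (Δx ^ (2 * p) * C' * |ω * k| ^ (2 * p + 2)) ^ 2)) := by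
          gcongr
      _ = _ := by ring
  have hE0 : 0 ≤ E * Δx ^ (2 * p) := by positivity
  simp_rw [hdiff]
  rw [integral_norm_sq_sum_exp hd, inv_mul_cancel_left₀ hd.ne', ← Real.sqrt_sq hE0,
    ← Real.sqrt_mul (sq_nonneg _)]
  refine Real.sqrt_le_sqrt ((Finset.sum_le_sum hbk).trans_eq ?_)
  rw [← Finset.mul_sum, Finset.sum_add_distrib, Finset.mul_sum, Finset.mul_sum]
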